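/- Let A = [A_{i,j}]_{i,j=1}^m ∈ M_m(M_n) be positive semidefinite, and let Ã ∈ M_n(M_m) be its realignment, defined by Ã = [B_{r,s}]_{r,s=1}^n where B_{r,s} = [a^{i,j}_{r,s}]_{i,j=1}^m and a^{i,j}_{r,s} denotes the (r,s) entry of the block A_{i,j}. Then (tr A) I_{nm} − (tr₁ A) ⊗ I_m ≥ I_n ⊗ (tr₂ A) − Ã. -/

import Mathlib

open Matrix Kronecker
open scoped ComplexOrder

/-- The first partial trace of an `m × m` block matrix with `n × n` blocks:
the sum of the diagonal blocks. -/
noncomputable def ptrace1 (m n : ℕ) (A : Matrix (Fin m × Fin n) (Fin m × Fin n) ℂ) :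
    Matrix (Fin n) (Fin n) ℂ :=
  Matrix.of fun r s => ∑ i, A (i, r) (i, s)

/-- The second partial trace of an `m × m` block matrix with `n × n` blocks:
the `m × m` matrix of traces of the blocks. -/
noncomputable def ptrace2 (m n : ℕ) (A : Matrix (Fin m × Fin n) (Fin m × Fin n) ℂ) :
    Matrix (Fin m) (Fin m) ℂ :=
  Matrix.of fun i j => ∑ r, A (i, r) (j, r)

/-- The realignment `Ã ∈ Mₙ(Mₘ)` of `A ∈ Mₘ(Mₙ)`: the `(r,s)` block of `Ã`
is the `m × m` matrix `[a^{i,j}_{r,s}]_{i,j}`. -/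
noncomputable def realign (m n : ℕ) (A : Matrix (Fin m × Fin n) (Fin m × Fin n) ℂ) :
    Matrix (Fin n × Fin m) (Fin n × Fin m) ℂ :=
  Matrix.of fun p q => A (p.2, p.1) (q.2, q.1)

/-- The map `X ↦ (tr X) I - Xᵀ` is completely positive: applied to the first tensor factor of a
positive semidefinite matrix, it yields a positive semidefinite matrix. -/
theorem posSemidef_trace_sub_transpose_left {α β : Type*} [Fintype α] [Fintype β] [DecidableEq α]
    [DecidableEq β] {A : Matrix (α × β) (α × β) ℂ} (hA : A.PosSemidef) :
    (Matrix.of fun p q : α × β =>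
      (if p.1 = q.1 then ∑ k, A (k, p.2) (k, q.2) else 0) - A (q.1, p.2) (p.1, q.2)).PosSemidef := by
  let W : α → α → Matrix (α × β) (α × β) ℂ := fun i j =>
    Matrix.of fun p a => if p.2 = a.2 then
      (if p.1 = i then if a.1 = j then 1 else 0 else 0)
        - (if p.1 = j then if a.1 = i then 1 else 0 else 0) else 0
  have hW : (∑ i, ∑ j, W i j * A * (W i j)ᴴ).PosSemidef :=
    posSemidef_sum _ fun i _ => posSemidef_sum _ fun j _ => hA.mul_mul_conjTranspose_same _
  have hmul : ∀ (i j : α) (B : Matrix (α × β) (α × β) ℂ) (p q : α × β), (W i j * B) p q =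
      (if p.1 = i then B (j, p.2) q else 0) - (if p.1 = j then B (i, p.2) q else 0) := by
    intro i j B p q
    simp [W, Matrix.mul_apply, Fintype.sum_prod_type, sub_mul, Finset.sum_sub_distrib, ite_mul]
  have hmul' : ∀ (i j : α) (B : Matrix (α × β) (α × β) ℂ) (p q : α × β), (B * (W i j)ᴴ) p q =
      (if q.1 = i then B p (j, q.2) else 0) - (if q.1 = j then B p (i, q.2) else 0) := by
    intro i j B p q
    have h := congrArg star (hmul i j Bᴴ q p)
    rw [← Matrix.conjTranspose_apply, Matrix.conjTranspose_mul, Matrix.conjTranspose_conjTranspose]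
      at h
    rw [h]
    simp only [star_sub, apply_ite star, Matrix.conjTranspose_apply, star_star, star_zero]
  have h2 := hW.smul (show (0 : ℂ) ≤ 1 / 2 by positivity)
  convert h2 using 1
  ext ⟨p, r⟩ ⟨q, s⟩
  simp only [Matrix.smul_apply, Matrix.sum_apply, hmul, hmul', Matrix.of_apply, smul_eq_mul]
  by_cases hpq : p = q
  · subst hpq
    simp [Finset.sum_sub_distrib]
    ring
  · simp [hpq, Finset.sum_sub_distrib]
    ring

/-- If `A` is positive semidefinite, then
`(tr A) I_{nm} − (tr₁ A) ⊗ Iₘ ≥ Iₙ ⊗ (tr₂ A) − Ã`. -/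
theorem stmt_9 (m n : ℕ) (A : Matrix (Fin m × Fin n) (Fin m × Fin n) ℂ)
    (hA : A.PosSemidef) :
    (A.trace • (1 : Matrix (Fin n × Fin m) (Fin n × Fin m) ℂ)
      - ptrace1 m n A ⊗ₖ (1 : Matrix (Fin m) (Fin m) ℂ)
      - ((1 : Matrix (Fin n) (Fin n) ℂ) ⊗ₖ ptrace2 m n A - realign m n A)).PosSemidef := by
  have h := posSemidef_trace_sub_transpose_left
    ((posSemidef_trace_sub_transpose_left hA.transpose).submatrix Prod.swap)
  convert h using 1
  ext ⟨r, i⟩ ⟨s, j⟩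
  simp only [ptrace1, ptrace2, realign, Matrix.trace, Matrix.sub_apply, Matrix.smul_apply,
    Matrix.kroneckerMap_apply, Matrix.one_apply, Matrix.of_apply, Matrix.submatrix_apply,
    Matrix.transpose_apply, Prod.swap, Prod.mk.injEq, Matrix.diag_apply, Fintype.sum_prod_type]
  by_cases hrs : r = s <;> by_cases hij : i = j <;>
    simp [hrs, hij, Finset.sum_sub_distrib, Finset.sum_comm (γ := Fin m)] <;> ring
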